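/- Define operators on ℚ(q)[X₀,X₁] acting on monomials X₀^{a}X₁^{b} by e(X₀^aX₁^b) = [2b] X₀^{a+1}X₁^{b-1}, f(X₀^aX₁^b) = [a] X₀^{a-1}X₁^{b+1}, k(X₀^aX₁^b) = q^{a-2b} X₀^aX₁^b (with terms vanishing when an exponent would become negative). Then e²f + f e² = (q + q⁻¹)(e f e − e(q k + q⁻¹ k⁻¹)) as operators. -/

import Mathlib

noncomputable section

/-- The field ℚ(q) of rational functions over ℚ. -/
abbrev K : Type := RatFunc ℚ

/-- The indeterminate q. -/
def q : K := RatFunc.X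

/-- The quantum integer [m]. -/
def qint (m : ℤ) : K := (q ^ m - q ^ (-m)) / (q - q⁻¹)

/-- The monomial X₀^a X₁^b in ℚ(q)[X₀,X₁]. -/
def mono (a b : ℕ) : MvPolynomial (Fin 2) K :=
  MvPolynomial.monomial (Finsupp.single 0 a + Finsupp.single 1 b) (1 : K)

lemma q_ne_zero : q ≠ 0 := RatFunc.X_ne_zero

lemma q_sub_ne : q - q⁻¹ ≠ 0 := by
  intro h
  have h1 : q * q = 1 := by
    have := q_ne_zero
    field_simp at h
    linear_combination h
  have h2 : (Polynomial.X * Polynomial.X : Polynomial ℚ) = 1 := by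
    apply RatFunc.algebraMap_injective ℚ
    simpa [q] using h1
  have h3 := congrArg (Polynomial.eval 2) h2
  norm_num at h3

lemma qint_zero : qint 0 = 0 := by simp [qint]

lemma key (a b : ℤ) :
    qint a * qint (2 * b + 2) + qint (a + 2) * qint (2 * b - 2)
      = (q + q⁻¹) * (qint (a + 1) * qint (2 * b)
        - (q * q ^ (a - 2 * b) + q⁻¹ * q ^ (2 * b - a))) := by
  have h0 := q_ne_zero
  have h1 := q_sub_ne
  have h2 : q ^ 2 - 1 ≠ 0 := by
    intro h
    apply h1
    field_simp
    linear_combination h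
  unfold qint
  have hA : q ^ a ≠ 0 := zpow_ne_zero _ h0
  have hB : q ^ (2 * b) ≠ 0 := zpow_ne_zero _ h0
  simp only [zpow_neg, zpow_add₀ h0, zpow_sub₀ h0, zpow_one, zpow_ofNat]
  generalize q ^ a = A at *
  generalize q ^ (2 * b) = B at *
  generalize q = t at *
  field_simp
  ring

lemma mono_ext {F G : Module.End K (MvPolynomial (Fin 2) K)}
    (h : ∀ a b, F (mono a b) = G (mono a b)) : F = G := by
  apply MvPolynomial.basisMonomials (Fin 2) K |>.ext
  intro s
  have hs : s = Finsupp.single 0 (s 0) + Finsupp.single 1 (s 1) := by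
    ext i
    fin_cases i <;> simp
  have := h (s 0) (s 1)
  unfold mono at this
  rw [← hs] at this
  simpa using this

/-- the relation e²f + fe² = (q+q⁻¹)(efe − e(qk + q⁻¹k⁻¹)) in the
oscillator representation of ⁱU(A₁). -/
theorem stmt12 (e f k k' : Module.End K (MvPolynomial (Fin 2) K))
    (he : ∀ a b : ℕ, e (mono a b) = qint (2 * (b : ℤ)) • mono (a + 1) (b - 1))
    (hf : ∀ a b : ℕ, f (mono a b) = qint (a : ℤ) • mono (a - 1) (b + 1))
    (hk : ∀ a b : ℕ, k (mono a b) = (q ^ ((a : ℤ) - 2 * (b : ℤ))) • mono a b)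
    (hk' : ∀ a b : ℕ, k' (mono a b) = (q ^ (2 * (b : ℤ) - (a : ℤ))) • mono a b) :
    e ^ 2 * f + f * e ^ 2
      = (q + q⁻¹) • (e * f * e - e * (q • k + q⁻¹ • k')) := by
  apply mono_ext
  intro a b
  have t1 : (qint (a : ℤ)) • (e (e (mono (a - 1) (b + 1))))
      = (qint (a : ℤ) * (qint (2 * b + 2) * qint (2 * b))) • mono (a + 1) (b - 1) := by
    rcases a with _ | a
    · simp [qint_zero]
    · simp only [he, map_smul, smul_smul, Nat.add_sub_cancel]
      push_cast
      ring_nf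
  have t2 : f (e (e (mono a b)))
      = (qint (2 * b) * qint (2 * b - 2) * qint (a + 2)) • mono (a + 1) (b - 1) := by
    rcases b with _ | _ | b
    · simp [he, qint_zero]
    · simp [he, qint_zero]
    · simp only [he, hf, map_smul, smul_smul, Nat.add_sub_cancel]
      push_cast
      ring_nf
  have t3 : e (f (e (mono a b)))
      = (qint (2 * b) * qint (2 * b) * qint (a + 1)) • mono (a + 1) (b - 1) := by
    rcases b with _ | b
    · simp [he, qint_zero]
    · simp only [he, hf, map_smul, smul_smul, Nat.add_sub_cancel]
      push_cast
      ring_nf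
  simp only [pow_two, LinearMap.add_apply, LinearMap.sub_apply, LinearMap.smul_apply,
    Module.End.mul_apply, map_add, map_smul, t2, t3]
  simp only [hf, hk, hk', map_smul, t1]
  simp only [he, smul_smul, ← add_smul, ← sub_smul]
  congr 1
  linear_combination qint (2 * b) * key a b
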